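/- Let 𝓜 be a loc-lattice of subsets of a set X which completely separates X. Then there exists a linear ordering ≤ of X such that every M ∈ 𝓜 is a convex subset of (X, ≤) and for all A, B ∈ 𝓜 the join A ∨ B equals the smallest convex subset of (X, ≤) containing A ∪ B (so 𝓜 is a sublattice of the lattice of all convex subsets of (X, ≤)). Moreover, every other linear ordering of X with this property is equal to ≤ or to the inverse order of ≤. -/

import Mathlib

universe u

/-- `(xyz)_𝓜` : every member of `𝓜` containing `x` and `z` also contains `y`. -/
def MBtw {X : Type u} (𝓜 : Set (Set X)) (x y z : X) : Prop :=
  ∀ M ∈ 𝓜, x ∈ M → z ∈ M → y ∈ M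

/-- Convexity of a set with respect to a relation `le`. -/
def RelConvex {X : Type u} (le : X → X → Prop) (S : Set X) : Prop :=
  ∀ a b c : X, a ∈ S → c ∈ S → le a b → le b c → b ∈ S

/-- A loc-lattice of subsets of `X`: `𝓜` is a lattice under inclusion whose joins are
given by `sup` and whose meets are intersections, satisfying conditions (1)-(4) of
Definition 2.1 of the paper. -/
structure SetLocLattice {X : Type u} (𝓜 : Set (Set X)) (sup : Set X → Set X → Set X) :
    Prop where
  sup_mem : ∀ A ∈ 𝓜, ∀ B ∈ 𝓜, sup A B ∈ 𝓜
  subset_sup_left : ∀ A ∈ 𝓜, ∀ B ∈ 𝓜, A ⊆ sup A B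
  subset_sup_right : ∀ A ∈ 𝓜, ∀ B ∈ 𝓜, B ⊆ sup A B
  sup_least : ∀ A ∈ 𝓜, ∀ B ∈ 𝓜, ∀ C ∈ 𝓜, A ⊆ C → B ⊆ C → sup A B ⊆ C
  inter_mem : ∀ A ∈ 𝓜, ∀ B ∈ 𝓜, A ∩ B ∈ 𝓜
  sup_eq_union : ∀ A ∈ 𝓜, ∀ B ∈ 𝓜, (A ∩ B).Nonempty → sup A B = A ∪ B
  trichotomy : ∀ A ∈ 𝓜, ∀ B ∈ 𝓜, ∀ C ∈ 𝓜,
    A ⊆ sup B C ∨ B ⊆ sup A C ∨ C ⊆ sup A B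
  incomp : ∀ A ∈ 𝓜, ∀ B ∈ 𝓜, ∀ C ∈ 𝓜,
    (¬ A ⊆ B ∧ ¬ B ⊆ A) → (¬ A ⊆ C ∧ ¬ C ⊆ A) → (¬ B ⊆ C ∧ ¬ C ⊆ B) →
    B ⊆ sup A C → B = sup A B ∩ sup C B

/-- `𝓜` separates the points of `X`. -/
def SeparatesPoints {X : Type u} (𝓜 : Set (Set X)) : Prop :=
  ∀ x y : X, x ≠ y → ∃ M ∈ 𝓜, (x ∈ M ∧ y ∉ M) ∨ (x ∉ M ∧ y ∈ M)

/-- `𝓜` well separates `X`. -/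
def WellSeparates {X : Type u} (𝓜 : Set (Set X)) : Prop :=
  SeparatesPoints 𝓜 ∧ ∀ M ∈ 𝓜, ∀ x : X, x ∉ M → ∃ N ∈ 𝓜, x ∈ N ∧ ¬ N ⊆ M

/-- Two points are completely separated by `𝓜`. -/
def CompSeparated {X : Type u} (𝓜 : Set (Set X)) (x y : X) : Prop :=
  ∃ A ∈ 𝓜, ∃ B ∈ 𝓜, x ∈ A ∧ y ∉ A ∧ y ∈ B ∧ x ∉ B

/-- `𝓜` completely separates `X`. -/
def CompletelySeparates {X : Type u} (𝓜 : Set (Set X)) : Prop :=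
  ∀ x y : X, x ≠ y → CompSeparated 𝓜 x y

namespace SetLocLattice

variable {X : Type u} {𝓜 : Set (Set X)} {sup : Set X → Set X → Set X}

theorem sup_comm (h : SetLocLattice 𝓜 sup) {A B : Set X} (hA : A ∈ 𝓜) (hB : B ∈ 𝓜) :
    sup A B = sup B A :=
  (h.sup_least A hA B hB _ (h.sup_mem B hB A hA) (h.subset_sup_right B hB A hA)
    (h.subset_sup_left B hB A hA)).antisymm
  (h.sup_least B hB A hA _ (h.sup_mem A hA B hB) (h.subset_sup_right A hA B hB)
    (h.subset_sup_left A hA B hB))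

/-- Among three pairwise incomparable members, one is the intersection of its joins with the
other two. -/
theorem eq_inter_sup (h : SetLocLattice 𝓜 sup) {A B C : Set X} (hA : A ∈ 𝓜) (hB : B ∈ 𝓜)
    (hC : C ∈ 𝓜) (hAB : ¬A ⊆ B ∧ ¬B ⊆ A) (hAC : ¬A ⊆ C ∧ ¬C ⊆ A) (hBC : ¬B ⊆ C ∧ ¬C ⊆ B) :
    A = sup A B ∩ sup A C ∨ B = sup A B ∩ sup B C ∨ C = sup A C ∩ sup B C := by
  rcases h.trichotomy A hA B hB C hC with h1 | h1 | h1
  · left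
    have := h.incomp B hB A hA C hC hAB.symm hBC hAC h1
    rwa [h.sup_comm hB hA, h.sup_comm hC hA] at this
  · right; left
    have := h.incomp A hA B hB C hC hAB hAC hBC h1
    rwa [h.sup_comm hC hB] at this
  · right; right
    exact h.incomp A hA C hC B hB hAC hAB hBC.symm h1

end SetLocLattice

section Betweenness

variable {X : Type u} {𝓜 : Set (Set X)} {sup : Set X → Set X → Set X}

theorem CompletelySeparates.exists_mem_notMem (hcs : CompletelySeparates 𝓜) {x y : X}
    (hxy : x ≠ y) : ∃ A ∈ 𝓜, x ∈ A ∧ y ∉ A := by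
  obtain ⟨A, hA, -, -, hx, hy, -⟩ := hcs x y hxy
  exact ⟨A, hA, hx, hy⟩

theorem SetLocLattice.exists_mem_notMem₂ (h : SetLocLattice 𝓜 sup)
    (hcs : CompletelySeparates 𝓜) {x y z : X} (hxy : x ≠ y) (hxz : x ≠ z) :
    ∃ A ∈ 𝓜, x ∈ A ∧ y ∉ A ∧ z ∉ A := by
  obtain ⟨A, hA, hxA, hyA⟩ := hcs.exists_mem_notMem hxy
  obtain ⟨B, hB, hxB, hzB⟩ := hcs.exists_mem_notMem hxz
  exact ⟨A ∩ B, h.inter_mem A hA B hB, ⟨hxA, hxB⟩, fun hy => hyA hy.1, fun hz => hzB hz.2⟩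

theorem SetLocLattice.exists_mem_notMem₃ (h : SetLocLattice 𝓜 sup)
    (hcs : CompletelySeparates 𝓜) {x y z w : X} (hxy : x ≠ y) (hxz : x ≠ z) (hxw : x ≠ w) :
    ∃ A ∈ 𝓜, x ∈ A ∧ y ∉ A ∧ z ∉ A ∧ w ∉ A := by
  obtain ⟨A, hA, hxA, hyA⟩ := hcs.exists_mem_notMem hxy
  obtain ⟨B, hB, hxB, hzB⟩ := h.exists_mem_notMem₂ hcs hxz hxw
  exact ⟨A ∩ B, h.inter_mem A hA B hB, ⟨hxA, hxB⟩, fun hy => hyA hy.1,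
    fun hz => hzB.1 hz.2, fun hw => hzB.2 hw.2⟩

namespace MBtw

theorem symm {x y z : X} (hb : MBtw 𝓜 x y z) : MBtw 𝓜 z y x :=
  fun M hM hz hx => hb M hM hx hz

theorem refl_left (x y : X) : MBtw 𝓜 x x y := fun _ _ hx _ => hx

theorem refl_right (x y : X) : MBtw 𝓜 x y y := fun _ _ _ hy => hy

theorem trans {x y z w : X} (h₁ : MBtw 𝓜 x y z) (h₂ : MBtw 𝓜 x z w) : MBtw 𝓜 x y w :=
  fun M hM hx hw => h₁ M hM hx (h₂ M hM hx hw)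

theorem trans_of_left {x y z w : X} (h₁ : MBtw 𝓜 x y z) (h₂ : MBtw 𝓜 y w z) : MBtw 𝓜 x w z :=
  fun M hM hx hz => h₂ M hM (h₁ M hM hx hz) hz

theorem eq_of_self (hcs : CompletelySeparates 𝓜) {x y : X} (hb : MBtw 𝓜 x y x) : x = y := by
  by_contra hxy
  obtain ⟨A, hA, hx, hy⟩ := hcs.exists_mem_notMem hxy
  exact hy (hb A hA hx hx)

theorem total (h : SetLocLattice 𝓜 sup) (x y z : X) :
    MBtw 𝓜 x y z ∨ MBtw 𝓜 y z x ∨ MBtw 𝓜 z x y := by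
  by_contra! hcon
  simp only [MBtw, not_forall] at hcon
  obtain ⟨⟨K, hK, hxK, hzK, hyK⟩, ⟨M, hM, hyM, hxM, hzM⟩, N, hN, hzN, hyN, hxN⟩ := hcon
  have key : ∀ {P Q R : Set X} {a : X}, P ∈ 𝓜 → Q ∈ 𝓜 → R ∈ 𝓜 → a ∈ P → a ∈ R → a ∉ Q →
      ¬P ∩ R ⊆ sup (P ∩ Q) (Q ∩ R) := fun {P Q R a} hP hQ hR haP haR haQ hs =>
    haQ (h.sup_least _ (h.inter_mem P hP Q hQ) _ (h.inter_mem Q hQ R hR) Q hQ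
      Set.inter_subset_right Set.inter_subset_left (hs ⟨haP, haR⟩))
  rcases h.trichotomy _ (h.inter_mem M hM N hN) _ (h.inter_mem N hN K hK) _
    (h.inter_mem K hK M hM) with h1 | h1 | h1
  · rw [Set.inter_comm M N, Set.inter_comm N K, h.sup_comm (h.inter_mem K hK N hN)
      (h.inter_mem K hK M hM), Set.inter_comm K M, Set.inter_comm N M] at h1
    exact key hM hK hN hyM hyN hyK h1
  · rw [Set.inter_comm N K, Set.inter_comm M N, Set.inter_comm K M, h.sup_comm
      (h.inter_mem N hN M hM) (h.inter_mem M hM K hK), h.sup_comm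
      (h.inter_mem M hM K hK) (h.inter_mem N hN M hM), Set.inter_comm K N] at h1
    exact key hN hM hK hzN hzK hzM h1
  · rw [Set.inter_comm K M] at h1
    exact key hM hN hK hxM hxK hxN h1

theorem eq_of_swap (h : SetLocLattice 𝓜 sup) (hcs : CompletelySeparates 𝓜) {x y z : X}
    (h₁ : MBtw 𝓜 x y z) (h₂ : MBtw 𝓜 x z y) : y = z := by
  by_contra hyz
  have hxy : x ≠ y := by rintro rfl; exact hyz (h₂.eq_of_self hcs)
  have hxz : x ≠ z := by rintro rfl; exact hyz (h₁.eq_of_self hcs).symm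
  obtain ⟨A, hA, hxA, hyA, hzA⟩ := h.exists_mem_notMem₂ hcs hxy hxz
  obtain ⟨B, hB, hyB, hxB, hzB⟩ := h.exists_mem_notMem₂ hcs hxy.symm hyz
  obtain ⟨C, hC, hzC, hxC, hyC⟩ := h.exists_mem_notMem₂ hcs hxz.symm (Ne.symm hyz)
  have := h₁ _ (h.sup_mem A hA C hC) (h.subset_sup_left A hA C hC hxA)
    (h.subset_sup_right A hA C hC hzC)
  have := h₂ _ (h.sup_mem A hA B hB) (h.subset_sup_left A hA B hB hxA)
    (h.subset_sup_right A hA B hB hyB)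
  have := h.subset_sup_right A hA B hB hyB
  have := h.subset_sup_right A hA C hC hzC
  have := h.subset_sup_left B hB C hC hyB
  have := h.subset_sup_right B hB C hC hzC
  rcases h.eq_inter_sup hA hB hC ⟨fun s => hxB (s hxA), fun s => hyA (s hyB)⟩
    ⟨fun s => hxC (s hxA), fun s => hzA (s hzC)⟩
    ⟨fun s => hyC (s hyB), fun s => hzB (s hzC)⟩ with e | e | e
  · exact hyA (e ▸ ⟨‹_›, ‹_›⟩)
  · exact hzB (e ▸ ⟨‹_›, ‹_›⟩)
  · exact hyC (e ▸ ⟨‹_›, ‹_›⟩)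

/-- No point lies strictly between each two of three points. -/
theorem not_star (h : SetLocLattice 𝓜 sup) (hcs : CompletelySeparates 𝓜) {o x y z : X}
    (hxy : MBtw 𝓜 x o y) (hxz : MBtw 𝓜 x o z) (hyz : MBtw 𝓜 y o z) :
    x = o ∨ y = o ∨ z = o := by
  by_contra! hne
  obtain ⟨hxo, hyo, hzo⟩ := hne
  have hxy' : x ≠ y := by rintro rfl; exact hxo (hxy.eq_of_self hcs)
  have hxz' : x ≠ z := by rintro rfl; exact hxo (hxz.eq_of_self hcs)
  have hyz' : y ≠ z := by rintro rfl; exact hyo (hyz.eq_of_self hcs)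
  obtain ⟨A, hA, hxA, hyA, hzA, hoA⟩ := h.exists_mem_notMem₃ hcs hxy' hxz' hxo
  obtain ⟨B, hB, hyB, hxB, hzB, hoB⟩ := h.exists_mem_notMem₃ hcs hxy'.symm hyz' hyo
  obtain ⟨C, hC, hzC, hxC, hyC, hoC⟩ := h.exists_mem_notMem₃ hcs hxz'.symm hyz'.symm hzo
  have hAB := hxy _ (h.sup_mem A hA B hB) (h.subset_sup_left A hA B hB hxA)
    (h.subset_sup_right A hA B hB hyB)
  have hAC := hxz _ (h.sup_mem A hA C hC) (h.subset_sup_left A hA C hC hxA)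
    (h.subset_sup_right A hA C hC hzC)
  have hBC := hyz _ (h.sup_mem B hB C hC) (h.subset_sup_left B hB C hC hyB)
    (h.subset_sup_right B hB C hC hzC)
  rcases h.eq_inter_sup hA hB hC ⟨fun s => hxB (s hxA), fun s => hyA (s hyB)⟩
    ⟨fun s => hxC (s hxA), fun s => hzA (s hzC)⟩
    ⟨fun s => hyC (s hyB), fun s => hzB (s hzC)⟩ with e | e | e
  · exact hoA (e ▸ ⟨hAB, hAC⟩)
  · exact hoB (e ▸ ⟨hAB, hBC⟩)
  · exact hoC (e ▸ ⟨hAC, hBC⟩)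

theorem trans_left (h : SetLocLattice 𝓜 sup) (hcs : CompletelySeparates 𝓜) {x y z w : X}
    (h₁ : MBtw 𝓜 x y z) (h₂ : MBtw 𝓜 x z w) : MBtw 𝓜 y z w := by
  rcases MBtw.total h y z w with h3 | h3 | h3
  · exact h3
  · obtain rfl := (h₁.trans_of_left h3.symm).eq_of_swap h hcs h₂
    exact refl_right _ _
  · rcases not_star h hcs h₁ (h₁.trans h₂) h3.symm with rfl | rfl | rfl
    · exact h₂
    · exact refl_left _ _
    · obtain rfl := h₁.eq_of_swap h hcs h₂
      exact refl_right _ _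


theorem split (h : SetLocLattice 𝓜 sup) {x y z : X} (hb : MBtw 𝓜 x y z) (w : X) :
    MBtw 𝓜 x y w ∨ MBtw 𝓜 w y z := by
  by_contra! hcon
  simp only [MBtw, not_forall] at hcon
  obtain ⟨⟨P, hP, hxP, hwP, hyP⟩, Q, hQ, hwQ, hzQ, hyQ⟩ := hcon
  have hy := hb _ (h.sup_mem P hP Q hQ) (h.subset_sup_left P hP Q hQ hxP)
    (h.subset_sup_right P hP Q hQ hzQ)
  rw [h.sup_eq_union P hP Q hQ ⟨w, hwP, hwQ⟩] at hy
  exact hy.elim hyP hyQ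

/-- If `o` separates neither `x` nor `y` from `e`, then it does not separate `x` from `y`. -/
theorem same_side (h : SetLocLattice 𝓜 sup) {o e x y : X} (hx : ¬MBtw 𝓜 x o e)
    (hy : ¬MBtw 𝓜 y o e) : ¬MBtw 𝓜 x o y :=
  fun hb => (hb.split h e).elim hx fun h' => hy h'.symm

end MBtw

/-- A point of the join outside both members lies between any two points of the members. -/
theorem MBtw.of_mem_sup (h : SetLocLattice 𝓜 sup) (hcs : CompletelySeparates 𝓜)
    {A B : Set X} (hA : A ∈ 𝓜) (hB : B ∈ 𝓜) {a b p : X} (ha : a ∈ A) (hb : b ∈ B)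
    (hp : p ∈ sup A B) (hpA : p ∉ A) (hpB : p ∉ B) : MBtw 𝓜 a p b := by
  have hAB : ∀ x ∈ A, x ∉ B := by
    intro x hxA hxB
    rw [h.sup_eq_union A hA B hB ⟨x, hxA, hxB⟩] at hp
    exact hp.elim hpA hpB
  obtain ⟨P, hP, hpP, haP, hbP⟩ := h.exists_mem_notMem₂ hcs
    (show p ≠ a by rintro rfl; exact hpA ha) (show p ≠ b by rintro rfl; exact hpB hb)
  have hpPA := h.subset_sup_left P hP A hA hpP
  have hpPB := h.subset_sup_left P hP B hB hpP
  have haPA := h.subset_sup_right P hP A hA ha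
  have hbPB := h.subset_sup_right P hP B hB hb
  rcases h.eq_inter_sup hP hA hB ⟨fun s => hpA (s hpP), fun s => haP (s ha)⟩
    ⟨fun s => hpB (s hpP), fun s => hbP (s hb)⟩
    ⟨fun s => hAB a ha (s ha), fun s => hAB b (s hb) hb⟩ with e' | e' | e'
  · rcases MBtw.total h a p b with h1 | h1 | h1
    · exact h1
    · exact absurd (e' ▸ ⟨h1 _ (h.sup_mem P hP A hA) hpPA haPA, hbPB⟩ : b ∈ P) hbP
    · exact absurd (e' ▸ ⟨haPA, h1 _ (h.sup_mem P hP B hB) hbPB hpPB⟩ : a ∈ P) haP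
  · exact absurd (e' ▸ ⟨hpPA, hp⟩ : p ∈ A) hpA
  · exact absurd (e' ▸ ⟨hpPB, hp⟩ : p ∈ B) hpB

/-- `x` is strictly on the other side of `o` than `e`. -/
def OppSide (𝓜 : Set (Set X)) (o e x : X) : Prop :=
  x ≠ o ∧ MBtw 𝓜 x o e

/-- The order pointing from `o` towards `e`: it increases away from `o` on the side of `e` and
decreases away from `o` on the opposite side. -/
def RayLE (𝓜 : Set (Set X)) (o e x y : X) : Prop :=
  (OppSide 𝓜 o e x ∧ OppSide 𝓜 o e y ∧ MBtw 𝓜 o y x) ∨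
  (OppSide 𝓜 o e x ∧ ¬OppSide 𝓜 o e y) ∨
  (¬OppSide 𝓜 o e x ∧ ¬OppSide 𝓜 o e y ∧ MBtw 𝓜 o x y)

theorem OppSide.mBtw (h : SetLocLattice 𝓜 sup) {o e x y : X} (hx : OppSide 𝓜 o e x)
    (hy : ¬OppSide 𝓜 o e y) : MBtw 𝓜 x o y := by
  by_cases hyo : y = o
  · subst hyo
    exact MBtw.refl_right _ _
  · exact (hx.2.split h y).resolve_right fun h' => hy ⟨hyo, h'⟩

theorem mBtw_or_mBtw_of_oppSide_iff (h : SetLocLattice 𝓜 sup) (hcs : CompletelySeparates 𝓜)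
    {o e x y : X} (heo : e ≠ o) (hxy : OppSide 𝓜 o e x ↔ OppSide 𝓜 o e y) :
    MBtw 𝓜 o x y ∨ MBtw 𝓜 o y x := by
  by_cases hxo : x = o
  · subst hxo
    exact .inl (MBtw.refl_left _ _)
  by_cases hyo : y = o
  · subst hyo
    exact .inr (MBtw.refl_left _ _)
  rcases MBtw.total h o x y with h1 | h1 | h1
  · exact .inl h1
  · exact .inr h1.symm
  · by_cases hx : OppSide 𝓜 o e x
    · rcases MBtw.not_star h hcs h1.symm hx.2 (hxy.1 hx).2 with rfl | rfl | rfl <;> contradiction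
    · exact absurd h1.symm (MBtw.same_side h (fun h' => hx ⟨hxo, h'⟩)
        fun h' => (mt hxy.2 hx) ⟨hyo, h'⟩)

theorem RayLE.isLinearOrder (h : SetLocLattice 𝓜 sup) (hcs : CompletelySeparates 𝓜)
    {o e : X} (heo : e ≠ o) : IsLinearOrder X (RayLE 𝓜 o e) where
  refl x := by
    have := MBtw.refl_right (𝓜 := 𝓜) o x
    unfold RayLE
    tauto
  trans x y z hxy hyz := by
    have h₁ : MBtw 𝓜 o x y → MBtw 𝓜 o y z → MBtw 𝓜 o x z := MBtw.trans
    have h₂ : MBtw 𝓜 o z y → MBtw 𝓜 o y x → MBtw 𝓜 o z x := MBtw.trans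
    unfold RayLE at *
    tauto
  antisymm x y hxy hyx := by
    have : MBtw 𝓜 o x y → MBtw 𝓜 o y x → x = y := MBtw.eq_of_swap h hcs
    unfold RayLE at *
    tauto
  total x y := by
    have := mBtw_or_mBtw_of_oppSide_iff h hcs (x := x) (y := y) heo
    unfold RayLE
    tauto

theorem RayLE.mBtw (h : SetLocLattice 𝓜 sup) (hcs : CompletelySeparates 𝓜) {o e a b c : X}
    (hab : RayLE 𝓜 o e a b) (hbc : RayLE 𝓜 o e b c) : MBtw 𝓜 a b c := by
  rcases hab with ⟨ha, hb, hab⟩ | ⟨ha, hb⟩ | ⟨ha, hb, hab⟩ <;>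
  rcases hbc with ⟨hb', hc, hbc⟩ | ⟨hb', hc⟩ | ⟨hb', hc, hbc⟩ <;> try contradiction
  · exact (hbc.trans_left h hcs hab).symm
  · exact hab.symm.trans (ha.mBtw h hc)
  · exact (hbc.symm.trans (ha.mBtw h hc).symm).symm
  · exact hab.trans_left h hcs hbc

section LinearOrder

variable {r : X → X → Prop}

theorem RayLE.le (h : SetLocLattice 𝓜 sup) (hcs : CompletelySeparates 𝓜)
    (hr : IsLinearOrder X r)
    (hbtw : ∀ a b c, r a b → r b c → MBtw 𝓜 a b c) {o e x y : X} (heo : e ≠ o) (hoe : r o e)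
    (hxy : RayLE 𝓜 o e x y) : r x y := by
  have hopp : ∀ z, OppSide 𝓜 o e z → r z o := by
    intro z hz
    refine (hr.total z o).resolve_right fun hoz => ?_
    rcases hr.total z e with hze | hez
    · exact hz.1 (MBtw.eq_of_swap h hcs hz.2.symm (hbtw _ _ _ hoz hze).symm).symm
    · exact heo (MBtw.eq_of_swap h hcs (hbtw _ _ _ hoe hez).symm hz.2)
  have hsame : ∀ z, ¬OppSide 𝓜 o e z → r o z := by
    intro z hz
    by_cases hzo : z = o
    · subst hzo
      exact hr.refl _
    · exact (hr.total o z).resolve_right fun hzo' => hz ⟨hzo, hbtw _ _ _ hzo' hoe⟩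
  rcases hxy with ⟨hx, hy, hxy⟩ | ⟨hx, hy⟩ | ⟨hx, hy, hxy⟩
  · rcases hr.total x y with h1 | h1
    · exact h1
    · obtain rfl := hxy.eq_of_swap h hcs (hbtw _ _ _ h1 (hopp x hx)).symm
      exact h1
  · exact hr.trans _ _ _ (hopp x hx) (hsame y hy)
  · rcases hr.total x y with h1 | h1
    · exact h1
    · obtain rfl := hxy.eq_of_swap h hcs (hbtw _ _ _ (hsame y hy) h1)
      exact h1

theorem RayLE.le_iff (h : SetLocLattice 𝓜 sup) (hcs : CompletelySeparates 𝓜)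
    (hr : IsLinearOrder X r) (hbtw : ∀ a b c, r a b → r b c → MBtw 𝓜 a b c) {o e : X}
    (heo : e ≠ o) (hoe : r o e) (x y : X) : r x y ↔ RayLE 𝓜 o e x y := by
  refine ⟨fun hxy => ?_, RayLE.le h hcs hr hbtw heo hoe⟩
  have hray := RayLE.isLinearOrder h hcs heo
  rcases hray.total x y with h1 | h1
  · exact h1
  · obtain rfl := hr.antisymm _ _ hxy (RayLE.le h hcs hr hbtw heo hoe h1)
    exact h1

theorem MBtw.le_and_le (h : SetLocLattice 𝓜 sup) (hcs : CompletelySeparates 𝓜)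
    (hr : IsLinearOrder X r) (hbtw : ∀ a b c, r a b → r b c → MBtw 𝓜 a b c) {a b c : X}
    (habc : MBtw 𝓜 a b c) : (r a b ∧ r b c) ∨ (r c b ∧ r b a) := by
  rcases hr.total a b with h1 | h1 <;> rcases hr.total b c with h2 | h2
  · exact .inl ⟨h1, h2⟩
  · rcases hr.total a c with h3 | h3
    · obtain rfl := habc.eq_of_swap h hcs (hbtw _ _ _ h3 h2)
      exact .inl ⟨h1, h2⟩
    · obtain rfl := habc.symm.eq_of_swap h hcs (hbtw _ _ _ h3 h1)
      exact .inr ⟨h2, h1⟩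
  · rcases hr.total a c with h3 | h3
    · obtain rfl := habc.symm.eq_of_swap h hcs (hbtw _ _ _ h1 h3).symm
      exact .inl ⟨h1, h2⟩
    · obtain rfl := habc.eq_of_swap h hcs (hbtw _ _ _ h2 h3).symm
      exact .inr ⟨h2, h1⟩
  · exact .inr ⟨h2, h1⟩

theorem SetLocLattice.sup_subset_of_relConvex (h : SetLocLattice 𝓜 sup)
    (hcs : CompletelySeparates 𝓜) (hr : IsLinearOrder X r)
    (hbtw : ∀ a b c, r a b → r b c → MBtw 𝓜 a b c) {A B S : Set X} (hA : A ∈ 𝓜) (hB : B ∈ 𝓜)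
    (hS : RelConvex r S) (hABS : A ∪ B ⊆ S) : sup A B ⊆ S := by
  intro p hp
  rcases A.eq_empty_or_nonempty with rfl | ⟨a, ha⟩
  · exact hABS (.inr (h.sup_least _ hA _ hB B hB (Set.empty_subset _) subset_rfl hp))
  rcases B.eq_empty_or_nonempty with rfl | ⟨b, hb⟩
  · exact hABS (.inl (h.sup_least _ hA _ hB A hA subset_rfl (Set.empty_subset _) hp))
  by_cases hpA : p ∈ A
  · exact hABS (.inl hpA)
  by_cases hpB : p ∈ B
  · exact hABS (.inr hpB)
  rcases (MBtw.of_mem_sup h hcs hA hB ha hb hp hpA hpB).le_and_le h hcs hr hbtw with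
    ⟨h1, h2⟩ | ⟨h1, h2⟩
  · exact hS a p b (hABS (.inl ha)) (hABS (.inr hb)) h1 h2
  · exact hS b p a (hABS (.inr hb)) (hABS (.inl ha)) h1 h2

end LinearOrder

end Betweenness

theorem completely_separating_loc_lattice_orderable_unique {X : Type u} (𝓜 : Set (Set X))
    (sup : Set X → Set X → Set X) (h : SetLocLattice 𝓜 sup)
    (hcs : CompletelySeparates 𝓜) :
    ∃ le : X → X → Prop, IsLinearOrder X le ∧
      (∀ M ∈ 𝓜, RelConvex le M) ∧
      (∀ A ∈ 𝓜, ∀ B ∈ 𝓜, A ∪ B ⊆ sup A B ∧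
        ∀ S : Set X, RelConvex le S → A ∪ B ⊆ S → sup A B ⊆ S) ∧
      ∀ le' : X → X → Prop, IsLinearOrder X le' →
        (∀ M ∈ 𝓜, RelConvex le' M) →
        (∀ A ∈ 𝓜, ∀ B ∈ 𝓜, A ∪ B ⊆ sup A B ∧
          ∀ S : Set X, RelConvex le' S → A ∪ B ⊆ S → sup A B ⊆ S) →
        ((∀ x y : X, le' x y ↔ le x y) ∨ (∀ x y : X, le' x y ↔ le y x)) := by
  have hsup : ∀ A ∈ 𝓜, ∀ B ∈ 𝓜, A ∪ B ⊆ sup A B := fun A hA B hB =>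
    Set.union_subset (h.subset_sup_left A hA B hB) (h.subset_sup_right A hA B hB)
  rcases subsingleton_or_nontrivial X with hX | hX
  · have hle : ∀ r : X → X → Prop, IsLinearOrder X r → ∀ x y, r x y := fun r hr x y =>
      Subsingleton.elim x y ▸ hr.refl x
    have hlin : IsLinearOrder X fun _ _ : X => True :=
      { refl := fun _ => trivial
        trans := fun _ _ _ _ _ => trivial
        antisymm := fun x y _ _ => Subsingleton.elim x y
        total := fun _ _ => .inl trivial }
    have hbtw : ∀ a b c : X, MBtw 𝓜 a b c := fun a b c =>
      Subsingleton.elim a b ▸ MBtw.refl_left a c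
    exact ⟨fun _ _ => True, hlin, fun M hM a b c ha hc _ _ => hbtw a b c M hM ha hc,
      fun A hA B hB => ⟨hsup A hA B hB, fun S hS =>
        h.sup_subset_of_relConvex hcs hlin (fun a b c _ _ => hbtw a b c) hA hB hS⟩,
      fun r hr _ _ => .inl fun x y => ⟨fun _ => trivial, fun _ => hle r hr x y⟩⟩
  · obtain ⟨o, e, hoe⟩ := exists_pair_ne X
    have hlin := RayLE.isLinearOrder h hcs hoe.symm
    refine ⟨RayLE 𝓜 o e, hlin, fun M hM a b c ha hc hab hbc => hab.mBtw h hcs hbc M hM ha hc,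
      fun A hA B hB => ⟨hsup A hA B hB, fun S hS => h.sup_subset_of_relConvex hcs hlin
        (fun a b c hab hbc => hab.mBtw h hcs hbc) hA hB hS⟩, fun r hr hconv _ => ?_⟩
    have hbtw : ∀ a b c, r a b → r b c → MBtw 𝓜 a b c := fun a b c hab hbc M hM ha hc =>
      hconv M hM a b c ha hc hab hbc
    rcases hr.total o e with h1 | h1
    · exact .inl (RayLE.le_iff h hcs hr hbtw hoe.symm h1)
    · have hswap : IsLinearOrder X (Function.swap r) :=
        { refl := hr.refl
          trans := fun a b c hab hbc => hr.trans c b a hbc hab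
          antisymm := fun a b hab hba => hr.antisymm a b hba hab
          total := fun a b => hr.total b a }
      exact .inr fun x y => RayLE.le_iff (r := Function.swap r) h hcs hswap
        (fun a b c hab hbc => (hbtw c b a hbc hab).symm) hoe.symm h1 y x
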